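/- Assume conditions (1.2) and (1.3), let u, v be a principal fundamental system of solutions of (r z')' = q z, and let p ∈ (1,∞). Define A(x) = (1/(2 d(x))) ∫_{x-d(x)}^{x+d(x)} q(t) dt and assume inf_{x∈ℝ} A(x) > 0 (so that the Green operator G is bounded on L_p(ℝ)). If A(x) → ∞ as |x| → ∞, then G : L_p(ℝ) → L_p(ℝ) is compact. -/

import Mathlib

open MeasureTheory Filter Topology
open scoped ENNReal RealInnerProductSpace

noncomputable section

/-- Conditions (1.2): `r, q` measurable, `r > 0`, `q ≥ 0`, with `1/r` and `q`
locally Lebesgue integrable on `ℝ`. -/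
def Cond12 (r q : ℝ → ℝ) : Prop :=
  Measurable r ∧ Measurable q ∧ (∀ x, 0 < r x) ∧ (∀ x, 0 ≤ q x) ∧
    LocallyIntegrable (fun t => 1 / r t) volume ∧ LocallyIntegrable q volume

/-- Condition (1.3): for every `x`,
`(∫_{x-d}^x dt/r(t)) · (∫_{x-d}^x q(t) dt) → ∞` as `|d| → ∞`. -/
def Cond13 (r q : ℝ → ℝ) : Prop :=
  ∀ x : ℝ, Tendsto (fun d : ℝ => (∫ t in x - d..x, 1 / r t) * (∫ t in x - d..x, q t))
    (cocompact ℝ) atTop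

/-- Condition (2.1): `∫_{-∞}^x q > 0` and `∫_x^∞ q > 0` for every `x`. -/
def Cond21 (q : ℝ → ℝ) : Prop :=
  ∀ x : ℝ, 0 < ∫⁻ t in Set.Iic x, ENNReal.ofReal (q t) ∧
    0 < ∫⁻ t in Set.Ici x, ENNReal.ofReal (q t)

/-- A principal fundamental system of solutions `u, v` (with a.e. derivatives
`u', v'`) of the equation `(r z')' = q z`:  `u, v, r u', r v'` are locally
absolutely continuous (expressed through the integral identities below),
`(r u')' = q u` and `(r v')' = q v` a.e., `u > 0`, `v > 0`, `v' ≥ 0`, `u' ≤ 0`,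
`r (v' u - u' v) ≡ 1`, `v/u → 0` at `-∞`, `u/v → 0` at `+∞`,
`∫_{-∞}^0 dt/(r u²) < ∞` and `∫_0^∞ dt/(r v²) < ∞`. -/
structure PFSS (r q u v u' v' : ℝ → ℝ) : Prop where
  u_pos : ∀ x, 0 < u x
  v_pos : ∀ x, 0 < v x
  u'_nonpos : ∀ x, u' x ≤ 0
  v'_nonneg : ∀ x, 0 ≤ v' x
  u'_intble : ∀ a b : ℝ, IntervalIntegrable u' volume a b
  v'_intble : ∀ a b : ℝ, IntervalIntegrable v' volume a b
  u_deriv : ∀ a b : ℝ, u b - u a = ∫ t in a..b, u' t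
  v_deriv : ∀ a b : ℝ, v b - v a = ∫ t in a..b, v' t
  ru'_deriv : ∀ a b : ℝ, r b * u' b - r a * u' a = ∫ t in a..b, q t * u t
  rv'_deriv : ∀ a b : ℝ, r b * v' b - r a * v' a = ∫ t in a..b, q t * v t
  wronskian : ∀ x, r x * (v' x * u x - u' x * v x) = 1
  ratio_bot : Tendsto (fun x => v x / u x) atBot (𝓝 0)
  ratio_top : Tendsto (fun x => u x / v x) atTop (𝓝 0)
  int_u : ∫⁻ t in Set.Iic (0:ℝ), ENNReal.ofReal (1 / (r t * u t ^ 2)) < ⊤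
  int_v : ∫⁻ t in Set.Ici (0:ℝ), ENNReal.ofReal (1 / (r t * v t ^ 2)) < ⊤

/-- The Green kernel `G(x,t) = u(x) v(t)` for `x ≥ t`, `u(t) v(x)` for `x ≤ t`. -/
def greenKernel (u v : ℝ → ℝ) (x t : ℝ) : ℝ :=
  if t ≤ x then u x * v t else u t * v x

/-- The space `L_p(ℝ)` (with respect to Lebesgue measure). -/
abbrev LpR (p : ℝ≥0∞) : Type := Lp ℝ p (volume : Measure ℝ)

/-- `G` is (a bounded realization on `L_p` of) the Green operator
`(G f)(x) = ∫_ℝ G(x,t) f(t) dt`. -/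
def IsGreenOp (u v : ℝ → ℝ) (p : ℝ≥0∞) [Fact (1 ≤ p)]
    (G : LpR p →L[ℝ] LpR p) : Prop :=
  ∀ f : LpR p,
    (G f : ℝ → ℝ) =ᵐ[volume] fun x => ∫ t, greenKernel u v x t * (f : ℝ → ℝ) t

/-- `d₁` solves `(∫_{x-d}^x dt/r)(∫_{x-d}^x q dt) = 1`, `d₁ > 0`. -/
def IsD1 (r q d₁ : ℝ → ℝ) : Prop :=
  ∀ x : ℝ, 0 < d₁ x ∧
    (∫ t in x - d₁ x..x, 1 / r t) * (∫ t in x - d₁ x..x, q t) = 1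

/-- `d₂` solves `(∫_x^{x+d} dt/r)(∫_x^{x+d} q dt) = 1`, `d₂ > 0`. -/
def IsD2 (r q d₂ : ℝ → ℝ) : Prop :=
  ∀ x : ℝ, 0 < d₂ x ∧
    (∫ t in x..x + d₂ x, 1 / r t) * (∫ t in x..x + d₂ x, q t) = 1

/-- `φ(x) = ∫_{x-d₁(x)}^x dt/r(t)`. -/
def phiF (r d₁ : ℝ → ℝ) (x : ℝ) : ℝ := ∫ t in x - d₁ x..x, 1 / r t

/-- `ψ(x) = ∫_x^{x+d₂(x)} dt/r(t)`. -/
def psiF (r d₂ : ℝ → ℝ) (x : ℝ) : ℝ := ∫ t in x..x + d₂ x, 1 / r t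

/-- `h(x) = φ(x)ψ(x)/(φ(x)+ψ(x))`. -/
def hF (r d₁ d₂ : ℝ → ℝ) (x : ℝ) : ℝ :=
  phiF r d₁ x * psiF r d₂ x / (phiF r d₁ x + psiF r d₂ x)

/-- `d` solves `∫_{x-d(x)}^{x+d(x)} dt/(r(t)h(t)) = 1`, `d > 0`. -/
def IsD (r h d : ℝ → ℝ) : Prop :=
  ∀ x : ℝ, 0 < d x ∧ (∫ t in x - d x..x + d x, 1 / (r t * h t)) = 1

/-- `s` solves `∫_{x-s(x)}^{x+s(x)} dt/(r(t)ρ(t)) = 1`, `s > 0`. -/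
def IsS (r ρ s : ℝ → ℝ) : Prop :=
  ∀ x : ℝ, 0 < s x ∧ (∫ t in x - s x..x + s x, 1 / (r t * ρ t)) = 1


lemma MeasureTheory.LocallyIntegrable.intervalIntegrable_real {f : ℝ → ℝ}
    (hf : LocallyIntegrable f volume) {a b : ℝ} : IntervalIntegrable f volume a b :=
  (hf.integrableOn_isCompact isCompact_uIcc).intervalIntegrable

namespace PFSS

variable {r q u v u' v' : ℝ → ℝ}

lemma antitone_u (h : PFSS r q u v u' v') : Antitone u := by
  intro a b hab
  have h1 := h.u_deriv a b
  have h2 : 0 ≤ ∫ t in a..b, -u' t :=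
    intervalIntegral.integral_nonneg hab fun t _ => neg_nonneg.2 (h.u'_nonpos t)
  rw [intervalIntegral.integral_neg] at h2
  linarith

lemma monotone_v (h : PFSS r q u v u' v') : Monotone v := by
  intro a b hab
  have h1 := h.v_deriv a b
  have h2 : 0 ≤ ∫ t in a..b, v' t :=
    intervalIntegral.integral_nonneg hab fun t _ => h.v'_nonneg t
  linarith

lemma continuous_u (h : PFSS r q u v u' v') : Continuous u := by
  have h1 : u = fun b => u 0 + ∫ t in (0:ℝ)..b, u' t := by
    funext b
    rw [← h.u_deriv]
    ring
  rw [h1]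
  exact continuous_const.add (intervalIntegral.continuous_primitive h.u'_intble 0)

lemma continuous_v (h : PFSS r q u v u' v') : Continuous v := by
  have h1 : v = fun b => v 0 + ∫ t in (0:ℝ)..b, v' t := by
    funext b
    rw [← h.v_deriv]
    ring
  rw [h1]
  exact continuous_const.add (intervalIntegral.continuous_primitive h.v'_intble 0)

/-- `r v' / v ≤ 2 / ∫_a^b dt/r` at the right end of an interval with
`(∫_a^b dt/r)(∫_a^b q) = 1`. -/
lemma flux_v_mul_le (h : PFSS r q u v u' v') (h12 : Cond12 r q) {a b : ℝ} (hab : a ≤ b)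
    (hone : (∫ t in a..b, 1 / r t) * (∫ t in a..b, q t) = 1) :
    r b * v' b * (∫ t in a..b, 1 / r t) ≤ 2 * v b := by
  obtain ⟨-, -, hr, hq, hri, hqi⟩ := h12
  have hqv : ∀ c e : ℝ, IntervalIntegrable (fun t => q t * v t) volume c e := fun c e =>
    (hqi.intervalIntegrable_real).mul_continuousOn h.continuous_v.continuousOn
  have hmono : ∀ t ∈ Set.Icc a b,
      (r b * v' b - v b * ∫ t in a..b, q t) * (1 / r t) ≤ v' t := by
    intro t ht
    have h1 := h.rv'_deriv t b
    have h2 : ∫ s in t..b, q s * v s ≤ ∫ s in t..b, q s * v b :=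
      intervalIntegral.integral_mono_on ht.2 (hqv _ _)
        ((hqi.intervalIntegrable_real).mul_const _) fun s hs =>
        mul_le_mul_of_nonneg_left (h.monotone_v hs.2) (hq s)
    have h3 : ∫ s in t..b, q s ≤ ∫ s in a..b, q s :=
      intervalIntegral.integral_mono_interval ht.1 ht.2 le_rfl
        (Eventually.of_forall hq) hqi.intervalIntegrable_real
    rw [intervalIntegral.integral_mul_const] at h2
    have h4 := mul_le_mul_of_nonneg_right h3 (h.v_pos b).le
    rw [mul_one_div, div_le_iff₀ (hr t)]
    linarith
  have h5 := intervalIntegral.integral_mono_on hab ((hri.intervalIntegrable_real).const_mul _)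
    (h.v'_intble a b) hmono
  rw [intervalIntegral.integral_const_mul, ← h.v_deriv a b] at h5
  have := h.v_pos a
  linear_combination h5 + this + v b * hone

/-- `-r u' / u ≤ 2 / ∫_a^b dt/r` at the left end of an interval with
`(∫_a^b dt/r)(∫_a^b q) = 1`. -/
lemma flux_u_mul_le (h : PFSS r q u v u' v') (h12 : Cond12 r q) {a b : ℝ} (hab : a ≤ b)
    (hone : (∫ t in a..b, 1 / r t) * (∫ t in a..b, q t) = 1) :
    -(r a * u' a) * (∫ t in a..b, 1 / r t) ≤ 2 * u a := by
  obtain ⟨-, -, hr, hq, hri, hqi⟩ := h12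
  have hqu : ∀ c e : ℝ, IntervalIntegrable (fun t => q t * u t) volume c e := fun c e =>
    (hqi.intervalIntegrable_real).mul_continuousOn h.continuous_u.continuousOn
  have hmono : ∀ t ∈ Set.Icc a b,
      u' t ≤ (r a * u' a + u a * ∫ t in a..b, q t) * (1 / r t) := by
    intro t ht
    have h1 := h.ru'_deriv a t
    have h2 : ∫ s in a..t, q s * u s ≤ ∫ s in a..t, q s * u a :=
      intervalIntegral.integral_mono_on ht.1 (hqu _ _)
        ((hqi.intervalIntegrable_real).mul_const _) fun s hs =>
        mul_le_mul_of_nonneg_left (h.antitone_u hs.1) (hq s)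
    have h3 : ∫ s in a..t, q s ≤ ∫ s in a..b, q s :=
      intervalIntegral.integral_mono_interval le_rfl ht.1 ht.2
        (Eventually.of_forall hq) hqi.intervalIntegrable_real
    rw [intervalIntegral.integral_mul_const] at h2
    have h4 := mul_le_mul_of_nonneg_right h3 (h.u_pos a).le
    rw [mul_one_div, le_div_iff₀ (hr t)]
    linarith
  have h5 := intervalIntegral.integral_mono_on hab (h.u'_intble a b)
    ((hri.intervalIntegrable_real).const_mul _) hmono
  rw [intervalIntegral.integral_const_mul, ← h.u_deriv a b] at h5
  have := h.u_pos b
  linear_combination h5 + this + u a * hone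

end PFSS

lemma integral_inv_pos_of_mul_eq_one {r q : ℝ → ℝ} (h12 : Cond12 r q) {a b : ℝ} (hab : a ≤ b)
    (hone : (∫ t in a..b, 1 / r t) * (∫ t in a..b, q t) = 1) :
    0 < ∫ t in a..b, 1 / r t := by
  refine lt_of_le_of_ne
    (intervalIntegral.integral_nonneg hab fun t _ => (one_div_pos.2 (h12.2.2.1 t)).le) ?_
  intro h0
  rw [← h0] at hone
  simp at hone

lemma phiF_pos {r q d₁ : ℝ → ℝ} (h12 : Cond12 r q) (hd₁ : IsD1 r q d₁) (x : ℝ) :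
    0 < phiF r d₁ x :=
  integral_inv_pos_of_mul_eq_one h12 (by linarith [(hd₁ x).1]) (hd₁ x).2

lemma psiF_pos {r q d₂ : ℝ → ℝ} (h12 : Cond12 r q) (hd₂ : IsD2 r q d₂) (x : ℝ) :
    0 < psiF r d₂ x :=
  integral_inv_pos_of_mul_eq_one h12 (by linarith [(hd₂ x).1]) (hd₂ x).2

lemma hF_pos {r q d₁ d₂ : ℝ → ℝ} (h12 : Cond12 r q) (hd₁ : IsD1 r q d₁) (hd₂ : IsD2 r q d₂)
    (x : ℝ) : 0 < hF r d₁ d₂ x := by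
  have h1 := phiF_pos h12 hd₁ x
  have h2 := psiF_pos h12 hd₂ x
  unfold hF
  positivity

namespace PFSS

variable {r q u v u' v' d₁ d₂ d : ℝ → ℝ}

/-- The diagonal `u v` of the Green kernel is at least `h / 2`. -/
lemma hF_le_two_mul (h : PFSS r q u v u' v') (h12 : Cond12 r q) (hd₁ : IsD1 r q d₁)
    (hd₂ : IsD2 r q d₂) (x : ℝ) : hF r d₁ d₂ x ≤ 2 * (u x * v x) := by
  have hφ := phiF_pos h12 hd₁ x
  have hψ := psiF_pos h12 hd₂ x
  have h1 : r x * v' x * phiF r d₁ x ≤ 2 * v x :=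
    h.flux_v_mul_le h12 (by linarith [(hd₁ x).1]) (hd₁ x).2
  have h2 : -(r x * u' x) * psiF r d₂ x ≤ 2 * u x :=
    h.flux_u_mul_le h12 (by linarith [(hd₂ x).1]) (hd₂ x).2
  have hw := h.wronskian x
  have hu := h.u_pos x
  have hv := h.v_pos x
  unfold hF
  rw [div_le_iff₀ (by positivity)]
  have h3 := mul_le_mul_of_nonneg_right h1 (mul_pos hu hψ).le
  have h4 := mul_le_mul_of_nonneg_right h2 (mul_pos hv hφ).le
  linear_combination h3 + h4 - phiF r d₁ x * psiF r d₂ x * hw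

lemma intervalIntegrable_inv (h : PFSS r q u v u' v') (h12 : Cond12 r q) (a b : ℝ) :
    IntervalIntegrable (fun t => 1 / (r t * (u t * v t))) volume a b := by
  have h1 : (fun t => 1 / (r t * (u t * v t))) = fun t => 1 / r t * (u t * v t)⁻¹ := by
    funext t
    rw [one_div, mul_inv, one_div]
  rw [h1]
  refine (h12.2.2.2.2.1.intervalIntegrable_real).mul_continuousOn (Continuous.continuousOn ?_)
  exact (h.continuous_u.mul h.continuous_v).inv₀ fun t => (mul_pos (h.u_pos t) (h.v_pos t)).ne'

lemma integral_inv_le_two (h : PFSS r q u v u' v') (h12 : Cond12 r q) (hd₁ : IsD1 r q d₁)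
    (hd₂ : IsD2 r q d₂) (hd : IsD r (hF r d₁ d₂) d) (y : ℝ) :
    ∫ t in y - d y..y + d y, 1 / (r t * (u t * v t)) ≤ 2 := by
  obtain ⟨hpos, hone⟩ := hd y
  have hint : IntervalIntegrable (fun t => 1 / (r t * hF r d₁ d₂ t)) volume
      (y - d y) (y + d y) :=
    intervalIntegral.intervalIntegrable_of_integral_ne_zero (by rw [hone]; exact one_ne_zero)
  have h1 := intervalIntegral.integral_mono_on (μ := volume) (by linarith : y - d y ≤ y + d y)
    (h.intervalIntegrable_inv h12 _ _) (hint.const_mul 2) (fun t _ => by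
      have h2 := h.hF_le_two_mul h12 hd₁ hd₂ t
      have h3 := hF_pos h12 hd₁ hd₂ t
      have h4 := h12.2.2.1 t
      have h5 := mul_pos (h.u_pos t) (h.v_pos t)
      rw [mul_one_div, div_le_div_iff₀ (by positivity) (by positivity)]
      have := mul_le_mul_of_nonneg_left h2 h4.le
      linarith)
  rw [intervalIntegral.integral_const_mul, hone] at h1
  linarith

lemma le_two_mul_of_integral_le (h : PFSS r q u v u' v') (h12 : Cond12 r q) {a b : ℝ}
    (hab : a ≤ b) (hk : ∫ t in a..b, 1 / (r t * (u t * v t)) ≤ 1 / 2) :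
    v b ≤ 2 * v a ∧ u a ≤ 2 * u b := by
  have hr := h12.2.2.1
  have hki := h.intervalIntegrable_inv h12 a b
  constructor
  · have h1 := intervalIntegral.integral_mono_on hab (h.v'_intble a b) (hki.const_mul (v b))
      (fun t ht => by
        have h2 := h.wronskian t
        have h3 := hr t
        have h4 := h.u_pos t
        have h5 := h.v_pos t
        have h6 := h.monotone_v ht.2
        have h7 : r t * v' t * u t ≤ 1 := by
          have := mul_nonneg (mul_nonneg h3.le (neg_nonneg.2 (h.u'_nonpos t))) h5.le
          linarith
        rw [mul_one_div, le_div_iff₀ (by positivity)]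
        have := mul_le_mul_of_nonneg_right h7 h5.le
        linarith)
    rw [intervalIntegral.integral_const_mul, ← h.v_deriv] at h1
    have := mul_le_mul_of_nonneg_left hk (h.v_pos b).le
    linarith
  · have h1 := intervalIntegral.integral_mono_on hab (h.u'_intble a b).neg
      (hki.const_mul (u a))
      (fun t ht => by
        have h2 := h.wronskian t
        have h3 := hr t
        have h4 := h.u_pos t
        have h5 := h.v_pos t
        have h6 := h.antitone_u ht.1
        have h7 : r t * (-u' t) * v t ≤ 1 := by
          have := mul_nonneg (mul_nonneg h3.le (h.v'_nonneg t)) h4.le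
          linarith
        rw [mul_one_div, le_div_iff₀ (by positivity)]
        have := mul_le_mul_of_nonneg_right h7 h4.le
        simp only [Pi.neg_apply]
        linarith)
    rw [intervalIntegral.integral_const_mul] at h1
    simp only [Pi.neg_apply] at h1
    rw [intervalIntegral.integral_neg, ← h.u_deriv] at h1
    have := mul_le_mul_of_nonneg_left hk (h.u_pos a).le
    linarith

/-- Halving: a doubling estimate with constant `C` on intervals of size `M` gives the constant
`C ^ 2` on intervals of size `2 * M`. -/
lemma le_sq_mul_of_halving (h : PFSS r q u v u' v') (h12 : Cond12 r q) {M C : ℝ} (hC : 0 ≤ C)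
    (hM : ∀ a b : ℝ, a ≤ b → ∫ t in a..b, 1 / (r t * (u t * v t)) ≤ M →
      v b ≤ C * v a ∧ u a ≤ C * u b) {a b : ℝ} (hab : a ≤ b)
    (hk : ∫ t in a..b, 1 / (r t * (u t * v t)) ≤ 2 * M) :
    v b ≤ C ^ 2 * v a ∧ u a ≤ C ^ 2 * u b := by
  set k : ℝ → ℝ := fun t => 1 / (r t * (u t * v t))
  have hki : ∀ a b, IntervalIntegrable k volume a b := h.intervalIntegrable_inv h12
  have hk0 : 0 ≤ ∫ t in a..b, k t := intervalIntegral.integral_nonneg hab fun t _ =>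
    (one_div_pos.2 (mul_pos (h12.2.2.1 t) (mul_pos (h.u_pos t) (h.v_pos t)))).le
  have hcont : ContinuousOn (fun c => ∫ t in a..c, k t) (Set.Icc a b) :=
    (intervalIntegral.continuous_primitive hki a).continuousOn
  have hmem : (∫ t in a..b, k t) / 2 ∈
      Set.Icc ((fun c => ∫ t in a..c, k t) a) ((fun c => ∫ t in a..c, k t) b) := by
    simp only [intervalIntegral.integral_same]
    constructor <;> linarith
  obtain ⟨c, hc, hce⟩ := intermediate_value_Icc hab hcont hmem
  have hce : ∫ t in a..c, k t = (∫ t in a..b, k t) / 2 := hce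
  have hadd := intervalIntegral.integral_add_adjacent_intervals (hki a c) (hki c b)
  obtain ⟨h1, h2⟩ := hM a c hc.1 (by linarith)
  obtain ⟨h3, h4⟩ := hM c b hc.2 (by linarith)
  have := mul_le_mul_of_nonneg_left h1 hC
  have := mul_le_mul_of_nonneg_left h4 hC
  constructor <;> linarith

/-- On `[y - d y, y + d y]` the solutions vary by a factor of at most `16`. -/
lemma le_sixteen_mul (h : PFSS r q u v u' v') (h12 : Cond12 r q) (hd₁ : IsD1 r q d₁)
    (hd₂ : IsD2 r q d₂) (hd : IsD r (hF r d₁ d₂) d) {y s t : ℝ}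
    (hs : s ∈ Set.Icc (y - d y) (y + d y)) (ht : t ∈ Set.Icc (y - d y) (y + d y)) :
    v t ≤ 16 * v s ∧ u t ≤ 16 * u s := by
  have hk : ∫ t in y - d y..y + d y, 1 / (r t * (u t * v t)) ≤ 2 * (2 * (1 / 2)) := by
    have := h.integral_inv_le_two h12 hd₁ hd₂ hd y
    linarith
  obtain ⟨h1, h2⟩ := h.le_sq_mul_of_halving h12 (by norm_num)
    (fun a b hab hk => h.le_sq_mul_of_halving h12 zero_le_two
      (fun a b hab hk => h.le_two_mul_of_integral_le h12 hab hk) hab hk)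
    (hs.1.trans hs.2) hk
  have h3 := h.monotone_v hs.1
  have h4 := h.monotone_v ht.2
  have h5 := h.antitone_u hs.2
  have h6 := h.antitone_u ht.1
  constructor <;> linarith

lemma greenKernel_eq_min (h : PFSS r q u v u' v') (x t : ℝ) :
    greenKernel u v x t = min (u x * v t) (u t * v x) := by
  have hu := (h.u_pos x).le
  have hv := (h.v_pos x).le
  have hv' := (h.v_pos t).le
  have hu' := (h.u_pos t).le
  unfold greenKernel
  split_ifs with htx
  · exact (min_eq_left (mul_le_mul (h.antitone_u htx) (h.monotone_v htx) hv' hu')).symm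
  · have hxt := (not_le.1 htx).le
    exact (min_eq_right (mul_le_mul (h.antitone_u hxt) (h.monotone_v hxt) hv hu)).symm

lemma greenKernel_pos (h : PFSS r q u v u' v') (x t : ℝ) : 0 < greenKernel u v x t := by
  rw [h.greenKernel_eq_min]
  exact lt_min (mul_pos (h.u_pos x) (h.v_pos t)) (mul_pos (h.u_pos t) (h.v_pos x))

lemma greenKernel_comm (h : PFSS r q u v u' v') (x t : ℝ) :
    greenKernel u v x t = greenKernel u v t x := by
  rw [h.greenKernel_eq_min, h.greenKernel_eq_min, min_comm]

lemma continuous_greenKernel (h : PFSS r q u v u' v') :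
    Continuous (fun z : ℝ × ℝ => greenKernel u v z.1 z.2) := by
  simp only [h.greenKernel_eq_min]
  have := h.continuous_u
  have := h.continuous_v
  fun_prop

lemma greenKernel_le_mul (h : PFSS r q u v u' v') {C : ℝ} {s t : ℝ} (hC : 0 ≤ C)
    (hv : v t ≤ C * v s) (hu : u t ≤ C * u s) (x : ℝ) :
    greenKernel u v x t ≤ C * greenKernel u v x s := by
  rw [h.greenKernel_eq_min, h.greenKernel_eq_min, mul_min_of_nonneg _ _ hC]
  have h1 := mul_le_mul_of_nonneg_left hv (h.u_pos x).le
  have h2 := mul_le_mul_of_nonneg_right hu (h.v_pos x).le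
  exact min_le_min (by linarith) (by linarith)

end PFSS

/-- Comparison of two measures through comparison on balls, by the Besicovitch covering theorem. -/
lemma exists_besicovitch_measure_le : ∃ N : ℕ, ∀ (μ ν : Measure ℝ) (S : Set ℝ) (ρ : ℝ → ℝ) (R : ℝ),
    (∀ y ∈ S, 0 < ρ y) → (∀ y ∈ S, ρ y ≤ R) →
    (∀ y ∈ S, μ (Metric.closedBall y (ρ y)) ≤ ν (Metric.closedBall y (ρ y))) →
    μ S ≤ N * ν Set.univ := by
  obtain ⟨N, τ, hτ, hN⟩ := HasBesicovitchCovering.no_satelliteConfig (α := ℝ)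
  refine ⟨N, fun μ ν S ρ R hpos hR hle => ?_⟩
  let B : Besicovitch.BallPackage S ℝ :=
    { c := fun y => y
      r := fun y => ρ y
      rpos := fun y => hpos y y.2
      r_bound := R
      r_le := fun y => hR y y.2 }
  obtain ⟨s, hdisj, hcov⟩ := Besicovitch.exist_disjoint_covering_families hτ hN B
  have hcount : ∀ i, (s i).Countable := fun i =>
    (hdisj i).countable_of_nonempty_interior fun y _ =>
      ⟨y, Metric.ball_subset_interior_closedBall (Metric.mem_ball_self (hpos y y.2))⟩
  have hsub : S ⊆ ⋃ i : Fin N, ⋃ j ∈ s i, Metric.closedBall (j : ℝ) (ρ j) := fun y hy => by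
    have h1 := hcov ⟨⟨y, hy⟩, rfl⟩
    simp only [Set.mem_iUnion] at h1 ⊢
    obtain ⟨i, j, hj, hyj⟩ := h1
    exact ⟨i, j, hj, Metric.ball_subset_closedBall hyj⟩
  have hfam : ∀ i, μ (⋃ j ∈ s i, Metric.closedBall (j : ℝ) (ρ j)) ≤ ν Set.univ := fun i => by
    calc μ (⋃ j ∈ s i, Metric.closedBall (j : ℝ) (ρ j))
        ≤ ∑' j : s i, μ (Metric.closedBall ((j : S) : ℝ) (ρ (j : S))) :=
          measure_biUnion_le μ (hcount i) _
      _ ≤ ∑' j : s i, ν (Metric.closedBall ((j : S) : ℝ) (ρ (j : S))) :=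
          ENNReal.tsum_le_tsum fun j => hle _ (j : S).2
      _ = ν (⋃ j ∈ s i, Metric.closedBall (j : ℝ) (ρ j)) :=
          (measure_biUnion (hcount i) (hdisj i) fun _ _ =>
            Metric.isClosed_closedBall.measurableSet).symm
      _ ≤ ν Set.univ := measure_mono (Set.subset_univ _)
  calc μ S ≤ μ (⋃ i : Fin N, ⋃ j ∈ s i, Metric.closedBall (j : ℝ) (ρ j)) := measure_mono hsub
    _ ≤ ∑ i : Fin N, μ (⋃ j ∈ s i, Metric.closedBall (j : ℝ) (ρ j)) :=
        measure_iUnion_fintype_le _ _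
    _ ≤ ∑ _i : Fin N, ν Set.univ := Finset.sum_le_sum fun i _ => hfam i
    _ = N * ν Set.univ := by simp

lemma lintegral_Ioc_ofReal {f : ℝ → ℝ} {a b : ℝ} (hab : a ≤ b)
    (hf : IntervalIntegrable f volume a b) (h0 : ∀ t, 0 ≤ f t) :
    ∫⁻ t in Set.Ioc a b, ENNReal.ofReal (f t) = ENNReal.ofReal (∫ t in a..b, f t) := by
  rw [intervalIntegral.integral_of_le hab]
  exact (ofReal_integral_eq_lintegral_ofReal
    ((intervalIntegrable_iff_integrableOn_Ioc_of_le hab).1 hf)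
    (Eventually.of_forall h0)).symm

lemma IsD.le_add_abs {r h d : ℝ → ℝ} (hd : IsD r h d) (hr : ∀ t, 0 < r t) (hh : ∀ t, 0 < h t)
    (y : ℝ) : d y ≤ d 0 + |y| := by
  by_contra! hlt
  obtain ⟨h0, h1⟩ := hd 0
  obtain ⟨h2, h3⟩ := hd y
  rw [zero_sub, zero_add] at h1
  have hpos : ∀ t, 0 < 1 / (r t * h t) := fun t => one_div_pos.2 (mul_pos (hr t) (hh t))
  have hint : IntervalIntegrable (fun t => 1 / (r t * h t)) volume (y - d y) (y + d y) :=
    intervalIntegral.intervalIntegrable_of_integral_ne_zero (by rw [h3]; exact one_ne_zero)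
  have hl : y - d y < -d 0 := by linarith [le_abs_self y]
  have hr' : d 0 < y + d y := by linarith [neg_abs_le y]
  have hsub : ∀ a b, a ∈ Set.Icc (y - d y) (y + d y) → b ∈ Set.Icc (y - d y) (y + d y) →
      IntervalIntegrable (fun t => 1 / (r t * h t)) volume a b := fun a b ha hb =>
    hint.mono_set ((Set.uIcc_subset_Icc ha hb).trans Set.Icc_subset_uIcc)
  have e1 := hsub (y - d y) (-d 0) ⟨le_rfl, by linarith⟩ ⟨hl.le, by linarith⟩
  have e2 := hsub (-d 0) (d 0) ⟨hl.le, by linarith⟩ ⟨by linarith, hr'.le⟩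
  have e3 := hsub (d 0) (y + d y) ⟨by linarith, hr'.le⟩ ⟨by linarith, le_rfl⟩
  have s1 := intervalIntegral.integral_add_adjacent_intervals e1 e2
  have s2 := intervalIntegral.integral_add_adjacent_intervals (e1.trans e2) e3
  have p1 := intervalIntegral.intervalIntegral_pos_of_pos_on e1 (fun t _ => hpos t) hl
  have p2 := intervalIntegral.intervalIntegral_pos_of_pos_on e3 (fun t _ => hpos t) hr'
  linarith

namespace PFSS

variable {r q u v u' v' d₁ d₂ d : ℝ → ℝ}

lemma measurable_greenKernel (h : PFSS r q u v u' v') (x : ℝ) :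
    Measurable fun t => ENNReal.ofReal (greenKernel u v x t) :=
  ENNReal.measurable_ofReal.comp
    (h.continuous_greenKernel.comp (continuous_const.prodMk continuous_id)).measurable

lemma integral_greenKernel_mul_le_one (h : PFSS r q u v u' v') (h12 : Cond12 r q)
    (x : ℝ) {a b : ℝ} (hax : a ≤ x) (hxb : x ≤ b) :
    ∫ t in a..b, greenKernel u v x t * q t ≤ 1 := by
  have hc : Continuous fun t => greenKernel u v x t :=
    h.continuous_greenKernel.comp (continuous_const.prodMk continuous_id)
  have hint : ∀ a b : ℝ, IntervalIntegrable (fun t => greenKernel u v x t * q t) volume a b :=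
    fun a b => h12.2.2.2.2.2.intervalIntegrable_real.continuousOn_mul hc.continuousOn
  have hl : ∫ t in a..x, greenKernel u v x t * q t = u x * (r x * v' x - r a * v' a) := by
    rw [h.rv'_deriv, ← intervalIntegral.integral_const_mul]
    refine intervalIntegral.integral_congr fun t ht => ?_
    rw [Set.uIcc_of_le hax] at ht
    simp only [greenKernel, if_pos ht.2]
    ring
  have hr : ∫ t in x..b, greenKernel u v x t * q t = v x * (r b * u' b - r x * u' x) := by
    rw [h.ru'_deriv, ← intervalIntegral.integral_const_mul]
    refine intervalIntegral.integral_congr fun t ht => ?_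
    rw [Set.uIcc_of_le hxb] at ht
    rw [h.greenKernel_comm x t]
    simp only [greenKernel, if_pos ht.1]
    ring
  rw [← intervalIntegral.integral_add_adjacent_intervals (hint a x) (hint x b), hl, hr]
  have h1 := mul_nonneg (h.u_pos x).le (mul_nonneg (h12.2.2.1 a).le (h.v'_nonneg a))
  have h2 := mul_nonneg (h.v_pos x).le (mul_nonneg (h12.2.2.1 b).le (neg_nonneg.2 (h.u'_nonpos b)))
  linear_combination h1 + h2 + h.wronskian x

lemma lintegral_greenKernel_mul_le_one (h : PFSS r q u v u' v') (h12 : Cond12 r q) (x : ℝ) :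
    ∫⁻ t, ENNReal.ofReal (greenKernel u v x t * q t) ≤ 1 := by
  have hc : Continuous fun t => greenKernel u v x t :=
    h.continuous_greenKernel.comp (continuous_const.prodMk continuous_id)
  have hmono : Monotone fun n : ℕ => Set.Ioc (x - n) (x + n) := fun m n hmn => by
    have : (m : ℝ) ≤ n := Nat.cast_le.2 hmn
    exact Set.Ioc_subset_Ioc (by linarith) (by linarith)
  have hun : ⋃ n : ℕ, Set.Ioc (x - n) (x + n) = Set.univ := by
    refine Set.eq_univ_of_forall fun t => ?_
    obtain ⟨n, hn⟩ := exists_nat_gt |t - x|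
    rw [abs_lt] at hn
    exact Set.mem_iUnion.2 ⟨n, by linarith, by linarith⟩
  rw [← setLIntegral_univ, ← hun, setLIntegral_iUnion_of_directed _ hmono.directed_le]
  refine iSup_le fun n => ?_
  have hn : (0 : ℝ) ≤ n := n.cast_nonneg
  rw [lintegral_Ioc_ofReal (by linarith)
    (h12.2.2.2.2.2.intervalIntegrable_real.continuousOn_mul hc.continuousOn)
    fun t => mul_nonneg (h.greenKernel_pos x t).le (h12.2.2.2.1 t)]
  exact ENNReal.ofReal_le_one.2
    (h.integral_greenKernel_mul_le_one h12 x (by linarith) (by linarith))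

/-- On the intervals `[y - d y, y + d y]` the kernel is controlled by its product with `q`. -/
lemma lintegral_closedBall_le (h : PFSS r q u v u' v') (h12 : Cond12 r q) (hd₁ : IsD1 r q d₁)
    (hd₂ : IsD2 r q d₂) (hd : IsD r (hF r d₁ d₂) d) {M y : ℝ} (hM : 0 < M)
    (hy : M ≤ 1 / (2 * d y) * ∫ t in y - d y..y + d y, q t) (x : ℝ) :
    ∫⁻ t in Metric.closedBall y (d y), ENNReal.ofReal (greenKernel u v x t) ≤
      ENNReal.ofReal (256 / M) *
        ∫⁻ t in Metric.closedBall y (d y), ENNReal.ofReal (greenKernel u v x t * q t) := by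
  have hdy := (hd y).1
  have hq := h12.2.2.2.1
  have hmem : y ∈ Set.Icc (y - d y) (y + d y) := ⟨by linarith, by linarith⟩
  have hG : ∀ s ∈ Set.Icc (y - d y) (y + d y), ∀ t ∈ Set.Icc (y - d y) (y + d y),
      greenKernel u v x t ≤ 16 * greenKernel u v x s := fun s hs t ht => by
    obtain ⟨h1, h2⟩ := h.le_sixteen_mul h12 hd₁ hd₂ hd hs ht
    exact h.greenKernel_le_mul (by norm_num) h1 h2 x
  have hq2 : 2 * d y * M ≤ ∫ t in y - d y..y + d y, q t := by
    rw [one_div_mul_eq_div, le_div_iff₀ (by positivity)] at hy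
    linarith
  have hg := h.greenKernel_pos x y
  rw [Real.closedBall_eq_Icc, setLIntegral_congr Ioc_ae_eq_Icc.symm,
    setLIntegral_congr (f := fun t => ENNReal.ofReal (greenKernel u v x t * q t))
      Ioc_ae_eq_Icc.symm]
  calc ∫⁻ t in Set.Ioc (y - d y) (y + d y), ENNReal.ofReal (greenKernel u v x t)
      ≤ ∫⁻ _t in Set.Ioc (y - d y) (y + d y), ENNReal.ofReal (16 * greenKernel u v x y) :=
        setLIntegral_mono' measurableSet_Ioc fun t ht =>
          ENNReal.ofReal_le_ofReal (hG y hmem t (Set.Ioc_subset_Icc_self ht))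
    _ = ENNReal.ofReal (16 * greenKernel u v x y * (2 * d y)) := by
        rw [setLIntegral_const, Real.volume_Ioc, ← ENNReal.ofReal_mul (by positivity)]
        congr 1
        ring
    _ ≤ ENNReal.ofReal (∫ t in y - d y..y + d y, 16 * greenKernel u v x y / M * q t) := by
        refine ENNReal.ofReal_le_ofReal ?_
        rw [intervalIntegral.integral_const_mul, div_mul_eq_mul_div, le_div_iff₀ hM]
        have := mul_le_mul_of_nonneg_left hq2 (by positivity : 0 ≤ 16 * greenKernel u v x y)
        linarith
    _ = ∫⁻ t in Set.Ioc (y - d y) (y + d y),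
          ENNReal.ofReal (16 * greenKernel u v x y / M * q t) :=
        (lintegral_Ioc_ofReal (by linarith)
          (h12.2.2.2.2.2.intervalIntegrable_real.const_mul _)
          fun t => mul_nonneg (by positivity) (hq t)).symm
    _ ≤ ∫⁻ t in Set.Ioc (y - d y) (y + d y),
          ENNReal.ofReal (256 / M) * ENNReal.ofReal (greenKernel u v x t * q t) := by
        refine setLIntegral_mono' measurableSet_Ioc fun t ht => ?_
        rw [← ENNReal.ofReal_mul (by positivity)]
        refine ENNReal.ofReal_le_ofReal ?_
        rw [← mul_assoc]
        refine mul_le_mul_of_nonneg_right ?_ (hq t)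
        rw [div_mul_eq_mul_div]
        have := hG t (Set.Ioc_subset_Icc_self ht) y hmem
        exact div_le_div_of_nonneg_right (by linarith) hM.le
    _ = _ := lintegral_const_mul' _ _ ENNReal.ofReal_ne_top

/-- The rows of the Green kernel, restricted to a set where the Steklov average of `q` is at
least `M`, have integral `O(1 / M)`. -/
lemma exists_lintegral_greenKernel_le (h : PFSS r q u v u' v') (h12 : Cond12 r q)
    (hd₁ : IsD1 r q d₁) (hd₂ : IsD2 r q d₂) (hd : IsD r (hF r d₁ d₂) d) :
    ∃ C : ℝ, 0 ≤ C ∧ ∀ M : ℝ, 0 < M → ∀ S : Set ℝ, MeasurableSet S →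
      (∀ y ∈ S, M ≤ 1 / (2 * d y) * ∫ t in y - d y..y + d y, q t) →
      ∀ x : ℝ, ∫⁻ t in S, ENNReal.ofReal (greenKernel u v x t) ≤ ENNReal.ofReal (C / M) := by
  obtain ⟨N, hN⟩ := exists_besicovitch_measure_le
  refine ⟨N * 256, by positivity, fun M hM S hS hSM x => ?_⟩
  have hmono : Monotone fun n : ℕ => S ∩ Metric.closedBall 0 (n : ℝ) := fun m n hmn =>
    Set.inter_subset_inter_right _ (Metric.closedBall_subset_closedBall (Nat.cast_le.2 hmn))
  have hun : S = ⋃ n : ℕ, S ∩ Metric.closedBall 0 (n : ℝ) := by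
    rw [← Set.inter_iUnion, Metric.iUnion_closedBall_nat, Set.inter_univ]
  rw [hun, setLIntegral_iUnion_of_directed _ hmono.directed_le]
  refine iSup_le fun n => ?_
  have hball : ∀ y, MeasurableSet (Metric.closedBall y (d y)) := fun y =>
    Metric.isClosed_closedBall.measurableSet
  have key := hN (volume.withDensity fun t => ENNReal.ofReal (greenKernel u v x t))
    (ENNReal.ofReal (256 / M) •
      volume.withDensity fun t => ENNReal.ofReal (greenKernel u v x t * q t))
    (S ∩ Metric.closedBall 0 (n : ℝ)) d (d 0 + n) (fun y _ => (hd y).1)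
    (fun y hy => (hd.le_add_abs h12.2.2.1 (hF_pos h12 hd₁ hd₂) y).trans
      (add_le_add_right (by simpa using hy.2) _))
    (fun y hy => by
      rw [Measure.smul_apply, withDensity_apply _ (hball y), withDensity_apply _ (hball y),
        smul_eq_mul]
      exact h.lintegral_closedBall_le h12 hd₁ hd₂ hd hM (hSM y hy.1) x)
  rw [Measure.smul_apply, withDensity_apply _ MeasurableSet.univ, setLIntegral_univ,
    withDensity_apply _ (hS.inter Metric.isClosed_closedBall.measurableSet), smul_eq_mul] at key
  refine key.trans ?_
  calc (N : ℝ≥0∞) * (ENNReal.ofReal (256 / M) *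
        ∫⁻ t, ENNReal.ofReal (greenKernel u v x t * q t))
      ≤ N * (ENNReal.ofReal (256 / M) * 1) := by
        gcongr
        exact h.lintegral_greenKernel_mul_le_one h12 x
    _ = ENNReal.ofReal (N * 256 / M) := by
        rw [mul_one, mul_div_assoc, ENNReal.ofReal_mul (by positivity), ENNReal.ofReal_natCast]

end PFSS

section Schur

lemma one_lt_toReal {p : ℝ≥0∞} (hp1 : 1 < p) (hp2 : p ≠ ⊤) : 1 < p.toReal := by
  rw [← ENNReal.toReal_one]
  exact (ENNReal.toReal_lt_toReal ENNReal.one_ne_top hp2).2 hp1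

lemma rpow_lintegral_mul_le {α : Type*} [MeasurableSpace α] {μ : Measure α} {p : ℝ} (hp : 1 < p)
    {k f : α → ℝ≥0∞} (hk : AEMeasurable k μ) (hf : AEMeasurable f μ) :
    (∫⁻ t, k t * f t ∂μ) ^ p ≤ (∫⁻ t, k t ∂μ) ^ (p - 1) * ∫⁻ t, k t * f t ^ p ∂μ := by
  have hpq := Real.HolderConjugate.conjExponent hp
  have h := ENNReal.lintegral_mul_le_Lp_mul_Lq (μ.withDensity k) hpq
    (hf.mono_ac (withDensity_absolutelyContinuous μ k)) (aemeasurable_const (b := 1))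
  simp only [Pi.mul_apply, mul_one, ENNReal.one_rpow] at h
  rw [lintegral_withDensity_eq_lintegral_mul₀ hk hf,
    lintegral_withDensity_eq_lintegral_mul₀ hk (hf.pow_const p), lintegral_one,
    withDensity_apply _ MeasurableSet.univ, Measure.restrict_univ] at h
  simp only [Pi.mul_apply] at h
  have hp0 : 0 < p := one_pos.trans hp
  refine (ENNReal.rpow_le_rpow h hp0.le).trans_eq ?_
  rw [ENNReal.mul_rpow_of_nonneg _ _ hp0.le, ← ENNReal.rpow_mul, ← ENNReal.rpow_mul,
    one_div_mul_cancel hp0.ne', ENNReal.rpow_one, mul_comm]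
  congr 2
  rw [one_div_mul_eq_div, Real.conjExponent, div_div_cancel₀ hp0.ne']

variable {K : ℝ → ℝ → ℝ} {C D : ℝ≥0∞}

/-- **Schur test**, in terms of lower Lebesgue integrals. -/
lemma lintegral_rpow_lintegral_mul_le {p : ℝ} (hp : 1 < p)
    (hK : Measurable (Function.uncurry K))
    (hC : ∀ x, ∫⁻ t, ‖K x t‖ₑ ≤ C) (hD : ∀ t, ∫⁻ x, ‖K x t‖ₑ ≤ D)
    {f : ℝ → ℝ} (hf : Measurable f) :
    ∫⁻ x, (∫⁻ t, ‖K x t * f t‖ₑ) ^ p ≤ C ^ (p - 1) * D * ∫⁻ t, ‖f t‖ₑ ^ p := by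
  have hKm : Measurable fun z : ℝ × ℝ => ‖K z.1 z.2‖ₑ := hK.enorm
  have hm : Measurable fun z : ℝ × ℝ => ‖K z.1 z.2‖ₑ * ‖f z.2‖ₑ ^ p :=
    hKm.mul ((hf.comp measurable_snd).enorm.pow_const p)
  calc ∫⁻ x, (∫⁻ t, ‖K x t * f t‖ₑ) ^ p
      ≤ ∫⁻ x, C ^ (p - 1) * ∫⁻ t, ‖K x t‖ₑ * ‖f t‖ₑ ^ p := by
        refine lintegral_mono fun x => ?_
        simp only [enorm_mul]
        refine (rpow_lintegral_mul_le hp (hKm.comp measurable_prodMk_left).aemeasurable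
          hf.enorm.aemeasurable).trans ?_
        exact mul_le_mul_left (ENNReal.rpow_le_rpow (hC x) (sub_nonneg.2 hp.le)) _
    _ = C ^ (p - 1) * ∫⁻ x, ∫⁻ t, ‖K x t‖ₑ * ‖f t‖ₑ ^ p :=
        lintegral_const_mul _ hm.lintegral_prod_right'
    _ = C ^ (p - 1) * ∫⁻ t, ∫⁻ x, ‖K x t‖ₑ * ‖f t‖ₑ ^ p := by
        rw [lintegral_lintegral_swap hm.aemeasurable]
    _ = C ^ (p - 1) * ∫⁻ t, (∫⁻ x, ‖K x t‖ₑ) * ‖f t‖ₑ ^ p := by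
        congr 1
        refine lintegral_congr fun t => ?_
        exact lintegral_mul_const _ (hKm.comp measurable_prodMk_right)
    _ ≤ C ^ (p - 1) * ∫⁻ t, D * ‖f t‖ₑ ^ p := by
        gcongr with t
        exact hD t
    _ = _ := by rw [lintegral_const_mul _ (hf.enorm.pow_const p), mul_assoc]

variable {p : ℝ≥0∞}

lemma lintegral_rpow_enorm_lt_top_of_Lp (hp1 : 1 < p) (hp2 : p ≠ ⊤) (f : LpR p) :
    ∫⁻ t, ‖f t‖ₑ ^ p.toReal < ⊤ :=
  lintegral_rpow_enorm_lt_top_of_eLpNorm_lt_top (one_pos.trans hp1).ne' hp2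
    (Lp.eLpNorm_lt_top f)

lemma ae_integrable_kernel_mul (hp1 : 1 < p) (hp2 : p ≠ ⊤)
    (hK : Measurable (Function.uncurry K)) (hCt : C ≠ ⊤) (hDt : D ≠ ⊤)
    (hC : ∀ x, ∫⁻ t, ‖K x t‖ₑ ≤ C) (hD : ∀ t, ∫⁻ x, ‖K x t‖ₑ ≤ D) (f : LpR p) :
    ∀ᵐ x, Integrable fun t => K x t * f t := by
  have hp : 1 < p.toReal := one_lt_toReal hp1 hp2
  have hf : Measurable (f : ℝ → ℝ) := (Lp.stronglyMeasurable f).measurable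
  have hm : Measurable fun z : ℝ × ℝ => K z.1 z.2 * f z.2 :=
    Measurable.mul hK (hf.comp measurable_snd)
  have hlt : ∫⁻ x, (∫⁻ t, ‖K x t * f t‖ₑ) ^ p.toReal < ⊤ :=
    (lintegral_rpow_lintegral_mul_le hp hK hC hD hf).trans_lt <| ENNReal.mul_lt_top
      (ENNReal.mul_lt_top (ENNReal.rpow_lt_top_of_nonneg (sub_nonneg.2 hp.le) hCt) hDt.lt_top)
      (lintegral_rpow_enorm_lt_top_of_Lp hp1 hp2 f)
  filter_upwards [ae_lt_top (hm.enorm.lintegral_prod_right'.pow_const _) hlt.ne] with x hx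
  refine ⟨(hm.comp measurable_prodMk_left).aestronglyMeasurable, ?_⟩
  exact (ENNReal.rpow_lt_top_iff_of_pos (one_pos.trans hp)).1 hx

lemma stronglyMeasurable_integral_kernel_mul (hK : Measurable (Function.uncurry K)) (f : LpR p) :
    StronglyMeasurable fun x => ∫ t, K x t * f t := by
  have hm : Measurable fun z : ℝ × ℝ => K z.1 z.2 * f z.2 :=
    Measurable.mul hK ((Lp.stronglyMeasurable f).measurable.comp measurable_snd)
  exact hm.stronglyMeasurable.integral_prod_right'

lemma eLpNorm_integral_kernel_mul_le (hp1 : 1 < p) (hp2 : p ≠ ⊤)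
    (hK : Measurable (Function.uncurry K))
    (hC : ∀ x, ∫⁻ t, ‖K x t‖ₑ ≤ C) (hD : ∀ t, ∫⁻ x, ‖K x t‖ₑ ≤ D) (f : LpR p) :
    eLpNorm (fun x => ∫ t, K x t * f t) p volume ≤
      (C ^ (p.toReal - 1) * D) ^ (1 / p.toReal) * eLpNorm f p volume := by
  have hp : 1 < p.toReal := one_lt_toReal hp1 hp2
  have hp0 : p ≠ 0 := (one_pos.trans hp1).ne'
  have hf : Measurable (f : ℝ → ℝ) := (Lp.stronglyMeasurable f).measurable
  rw [eLpNorm_eq_lintegral_rpow_enorm_toReal hp0 hp2,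
    eLpNorm_eq_lintegral_rpow_enorm_toReal hp0 hp2,
    ← ENNReal.mul_rpow_of_nonneg _ _ (by positivity)]
  gcongr
  refine le_trans ?_ (lintegral_rpow_lintegral_mul_le hp hK hC hD hf)
  gcongr with x
  exact enorm_integral_le_lintegral_enorm _

/-- **Schur test**: a kernel with bounded rows and columns gives a bounded integral operator. -/
lemma exists_clm_of_schur [Fact (1 ≤ p)] (hp1 : 1 < p) (hp2 : p ≠ ⊤)
    (hK : Measurable (Function.uncurry K)) (hCt : C ≠ ⊤) (hDt : D ≠ ⊤)
    (hC : ∀ x, ∫⁻ t, ‖K x t‖ₑ ≤ C) (hD : ∀ t, ∫⁻ x, ‖K x t‖ₑ ≤ D) :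
    ∃ T : LpR p →L[ℝ] LpR p, (∀ f : LpR p, (T f : ℝ → ℝ) =ᵐ[volume] fun x => ∫ t, K x t * f t) ∧
      ‖T‖ ≤ ((C ^ (p.toReal - 1) * D) ^ (1 / p.toReal)).toReal := by
  have hp : 1 < p.toReal := one_lt_toReal hp1 hp2
  have hBt : (C ^ (p.toReal - 1) * D) ^ (1 / p.toReal) ≠ ⊤ :=
    ENNReal.rpow_ne_top_of_nonneg (by positivity) <| ENNReal.mul_ne_top
      (ENNReal.rpow_ne_top_of_nonneg (sub_nonneg.2 hp.le) hCt) hDt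
  have hle := eLpNorm_integral_kernel_mul_le (p := p) hp1 hp2 hK hC hD
  have hmem : ∀ f : LpR p, MemLp (fun x => ∫ t, K x t * f t) p volume := fun f =>
    ⟨(stronglyMeasurable_integral_kernel_mul hK f).aestronglyMeasurable,
      (hle f).trans_lt (ENNReal.mul_lt_top hBt.lt_top (Lp.eLpNorm_lt_top f))⟩
  let L : LpR p →ₗ[ℝ] LpR p :=
    { toFun := fun f => (hmem f).toLp _
      map_add' := fun f g => by
        rw [← MemLp.toLp_add, MemLp.toLp_eq_toLp_iff]
        filter_upwards [ae_integrable_kernel_mul hp1 hp2 hK hCt hDt hC hD f,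
          ae_integrable_kernel_mul hp1 hp2 hK hCt hDt hC hD g] with x hf hg
        rw [Pi.add_apply, ← integral_add hf hg]
        refine integral_congr_ae ?_
        filter_upwards [Lp.coeFn_add f g] with t ht
        rw [ht, Pi.add_apply, mul_add]
      map_smul' := fun c f => by
        rw [RingHom.id_apply, ← MemLp.toLp_const_smul, MemLp.toLp_eq_toLp_iff]
        refine Eventually.of_forall fun x => ?_
        simp only [Pi.smul_apply, smul_eq_mul]
        rw [← integral_const_mul]
        refine integral_congr_ae ?_
        filter_upwards [Lp.coeFn_smul c f] with t ht
        rw [ht, Pi.smul_apply, smul_eq_mul]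
        ring }
  have hL : ∀ f, ‖L f‖ ≤ ((C ^ (p.toReal - 1) * D) ^ (1 / p.toReal)).toReal * ‖f‖ := fun f => by
    change ‖(hmem f).toLp _‖ ≤ _
    rw [Lp.norm_toLp, Lp.norm_def, ← ENNReal.toReal_mul]
    exact ENNReal.toReal_mono (ENNReal.mul_ne_top hBt (Lp.eLpNorm_ne_top f)) (hle f)
  exact ⟨L.mkContinuous _ hL, fun f => (hmem f).coeFn_toLp,
    L.mkContinuous_norm_le ENNReal.toReal_nonneg hL⟩

end Schur

section FiniteRank

variable {p : ℝ≥0∞}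

/-- The rank-one operator `f ↦ (∫_J f) φ` on `L_p`. -/
lemma exists_compact_rank_one [Fact (1 ≤ p)] {φ : ℝ → ℝ}
    (hφ : MemLp φ p volume) {J : Set ℝ} (hJ : MeasurableSet J) (hJt : volume J ≠ ⊤) :
    ∃ F : LpR p →L[ℝ] LpR p, IsCompactOperator F ∧
      ∀ f : LpR p, (F f : ℝ → ℝ) =ᵐ[volume] fun x => φ x * ∫ t in J, f t := by
  have : ENNReal.HolderConjugate (ENNReal.conjExponent p) p :=
    (ENNReal.HolderConjugate.conjExponent Fact.out).symm
  have : Fact (1 ≤ ENNReal.conjExponent p) := ⟨ENNReal.HolderConjugate.one_le _ p⟩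
  let L : LpR p →L[ℝ] ℝ := (ContinuousLinearMap.mul ℝ ℝ).lpPairing volume
    (ENNReal.conjExponent p) p (indicatorConstLp _ hJ hJt 1)
  have hL : ∀ f : LpR p, L f = ∫ t in J, f t := fun f => by
    simp only [L, ContinuousLinearMap.lpPairing_eq_integral, ContinuousLinearMap.mul_apply']
    rw [← integral_indicator hJ]
    refine integral_congr_ae ?_
    filter_upwards [indicatorConstLp_coeFn (p := ENNReal.conjExponent p) (hs := hJ) (hμs := hJt)
      (c := (1 : ℝ))] with t ht
    rw [ht]
    by_cases htJ : t ∈ J <;> simp [htJ]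
  have hLc : IsCompactOperator L := isCompactOperator_of_locallyCompactSpace_dom L
  refine ⟨L.smulRight (hφ.toLp φ),
    hLc.clm_comp (ContinuousLinearMap.toSpanSingleton ℝ (hφ.toLp φ)), fun f => ?_⟩
  rw [ContinuousLinearMap.smulRight_apply, hL]
  filter_upwards [Lp.coeFn_smul (∫ t in J, f t) (hφ.toLp φ), hφ.coeFn_toLp] with x h1 h2
  rw [h1, Pi.smul_apply, h2, smul_eq_mul, mul_comm]

lemma exists_compact_finite_rank [Fact (1 ≤ p)] {ι : Type*} (I : Finset ι) {φ : ι → ℝ → ℝ}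
    (hφ : ∀ k, MemLp (φ k) p volume) {J : ι → Set ℝ} (hJ : ∀ k, MeasurableSet (J k))
    (hJt : ∀ k, volume (J k) ≠ ⊤) :
    ∃ F : LpR p →L[ℝ] LpR p, IsCompactOperator F ∧
      ∀ f : LpR p, (F f : ℝ → ℝ) =ᵐ[volume]
        fun x => ∫ t, (∑ k ∈ I, φ k x * (J k).indicator 1 t) * f t := by
  choose F hFc hF using fun k => exists_compact_rank_one (hφ k) (hJ k) (hJt k)
  refine ⟨∑ k ∈ I, F k,
    (compactOperator (RingHom.id ℝ) (LpR p) (LpR p)).sum_mem fun k _ => hFc k, fun f => ?_⟩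
  rw [_root_.sum_apply]
  have hae : ∀ᵐ x, ∀ k ∈ I, F k f x = φ k x * ∫ t in J k, f t :=
    (Finset.eventually_all I).2 fun k _ => hF k f
  filter_upwards [hae, Lp.coeFn_finsetSum I fun k => F k f] with x hx hs
  have hint : ∀ k, IntegrableOn (f : ℝ → ℝ) (J k) := fun k =>
    have : IsFiniteMeasure (volume.restrict (J k)) := ⟨by simpa using (hJt k).lt_top⟩
    ((Lp.memLp f).restrict (J k)).integrable Fact.out
  rw [hs, Finset.sum_apply, Finset.sum_congr rfl hx]
  simp_rw [Finset.sum_mul]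
  have heq : ∀ k t, φ k x * (J k).indicator 1 t * f t = φ k x * (J k).indicator f t := by
    intro k t
    by_cases htJ : t ∈ J k <;> simp [htJ]
  simp_rw [heq]
  rw [integral_finsetSum]
  · refine Finset.sum_congr rfl fun k _ => ?_
    rw [integral_const_mul, integral_indicator (hJ k)]
  · exact fun k _ => ((integrable_indicator_iff (hJ k)).2 (hint k)).const_mul _

end FiniteRank

namespace PFSS

variable {r q u v u' v' : ℝ → ℝ} {p : ℝ≥0∞}

lemma greenKernel_le_diag (h : PFSS r q u v u' v') (x t : ℝ) :
    greenKernel u v x t ≤ u t * v t := by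
  rw [greenKernel]
  split_ifs with htx
  · exact mul_le_mul_of_nonneg_right (h.antitone_u htx) (h.v_pos t).le
  · exact mul_le_mul_of_nonneg_left (h.monotone_v (not_le.1 htx).le) (h.u_pos t).le

lemma enorm_greenKernel (h : PFSS r q u v u' v') (x t : ℝ) :
    ‖greenKernel u v x t‖ₑ = ENNReal.ofReal (greenKernel u v x t) :=
  Real.enorm_of_nonneg (h.greenKernel_pos x t).le

lemma memLp_greenKernel (h : PFSS r q u v u' v') (hp1 : 1 < p) (hp2 : p ≠ ⊤) (s : ℝ)
    (hs : ∫⁻ x, ENNReal.ofReal (greenKernel u v x s) < ⊤) :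
    MemLp (fun x => greenKernel u v x s) p volume := by
  have hp : 1 < p.toReal := one_lt_toReal hp1 hp2
  have hc : Continuous fun x => greenKernel u v x s :=
    h.continuous_greenKernel.comp (by fun_prop : Continuous fun x : ℝ => (x, s))
  refine ⟨hc.aestronglyMeasurable, ?_⟩
  rw [eLpNorm_lt_top_iff_lintegral_rpow_enorm_lt_top (one_pos.trans hp1).ne' hp2]
  calc ∫⁻ x, ‖greenKernel u v x s‖ₑ ^ p.toReal
      ≤ ∫⁻ x, ENNReal.ofReal (u s * v s) ^ (p.toReal - 1) *
          ENNReal.ofReal (greenKernel u v x s) := by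
        refine lintegral_mono fun x => ?_
        have h0 := h.greenKernel_pos x s
        have hle := h.greenKernel_le_diag x s
        rw [h.enorm_greenKernel]
        nth_rewrite 1 [← sub_add_cancel p.toReal 1]
        rw [ENNReal.rpow_add_of_nonneg _ _ (sub_nonneg.2 hp.le) zero_le_one, ENNReal.rpow_one]
        exact mul_le_mul_left (ENNReal.rpow_le_rpow (ENNReal.ofReal_le_ofReal hle)
          (sub_nonneg.2 hp.le)) _
    _ < ⊤ := by
        rw [lintegral_const_mul _ hc.measurable.ennreal_ofReal]
        exact ENNReal.mul_lt_top
          (ENNReal.rpow_lt_top_of_nonneg (sub_nonneg.2 hp.le) ENNReal.ofReal_ne_top) hs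

/-- Relative uniform continuity of the Green kernel in the second variable on compact intervals. -/
lemma exists_abs_greenKernel_sub_le (h : PFSS r q u v u' v') (N : ℝ) {δ : ℝ} (hδ : 0 < δ) :
    ∃ ρ > 0, ∀ s ∈ Set.Icc (-N) N, ∀ t ∈ Set.Icc (-N) N, |s - t| < ρ →
      ∀ x, |greenKernel u v x t - greenKernel u v x s| ≤ δ * greenKernel u v x t := by
  obtain ⟨ρ₁, hρ₁, H₁⟩ := Metric.uniformContinuousOn_iff.1
    (isCompact_Icc.uniformContinuousOn_of_continuous
      (h.continuous_u.continuousOn (s := Set.Icc (-N) N)))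
    (δ * u N) (mul_pos hδ (h.u_pos N))
  obtain ⟨ρ₂, hρ₂, H₂⟩ := Metric.uniformContinuousOn_iff.1
    (isCompact_Icc.uniformContinuousOn_of_continuous
      (h.continuous_v.continuousOn (s := Set.Icc (-N) N)))
    (δ * v (-N)) (mul_pos hδ (h.v_pos (-N)))
  have key : ∀ s ∈ Set.Icc (-N) N, ∀ t ∈ Set.Icc (-N) N, |s - t| < min ρ₁ ρ₂ →
      ∀ x, greenKernel u v x t ≤ (1 + δ) * greenKernel u v x s := by
    intro s hs t ht hst x
    have hu := (abs_lt.1 (H₁ s hs t ht (hst.trans_le (min_le_left _ _)))).1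
    have hv := (abs_lt.1 (H₂ s hs t ht (hst.trans_le (min_le_right _ _)))).1
    have hu' := mul_le_mul_of_nonneg_left (h.antitone_u hs.2) hδ.le
    have hv' := mul_le_mul_of_nonneg_left (h.monotone_v hs.1) hδ.le
    exact h.greenKernel_le_mul (by positivity) (by linarith) (by linarith) x
  refine ⟨min ρ₁ ρ₂, lt_min hρ₁ hρ₂, fun s hs t ht hst x => abs_le.2 ?_⟩
  have h1 := key s hs t ht hst x
  have h2 := key t ht s hs (abs_sub_comm s t ▸ hst) x
  have ht0 := h.greenKernel_pos x t
  refine ⟨by linarith, ?_⟩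
  have : (1 + δ) * (greenKernel u v x t - greenKernel u v x s) ≤
      (1 + δ) * (δ * greenKernel u v x t) := by
    nlinarith [mul_pos (mul_pos hδ hδ) ht0]
  exact le_of_mul_le_mul_left this (by positivity)

end PFSS

namespace PFSS

variable {r q u v u' v' : ℝ → ℝ} {p : ℝ≥0∞}

lemma exists_compact_norm_sub_le [Fact (1 ≤ p)] (h : PFSS r q u v u' v') (hp1 : 1 < p) (hp2 : p ≠ ⊤)
    {C : ℝ} (hC0 : 0 ≤ C) (hC : ∀ x, ∫⁻ t, ENNReal.ofReal (greenKernel u v x t) ≤ ENNReal.ofReal C)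
    (htail : ∀ η : ℝ, 0 < η → ∃ N : ℕ, ∀ x,
      ∫⁻ t in (Set.Ico (-N : ℝ) N)ᶜ, ENNReal.ofReal (greenKernel u v x t) ≤ ENNReal.ofReal η)
    {G : LpR p →L[ℝ] LpR p} (hG : IsGreenOp u v p G) {η : ℝ} (hη : 0 < η) :
    ∃ F : LpR p →L[ℝ] LpR p, IsCompactOperator F ∧ ‖G - F‖ ≤
      ((ENNReal.ofReal η ^ (p.toReal - 1) * ENNReal.ofReal C) ^ (1 / p.toReal)).toReal := by
  have hcol : ∀ t, ∫⁻ x, ENNReal.ofReal (greenKernel u v x t) ≤ ENNReal.ofReal C := fun t => by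
    simp_rw [fun x => h.greenKernel_comm x t]
    exact hC t
  have hcolt : ∀ t, ∫⁻ x, ENNReal.ofReal (greenKernel u v x t) < ⊤ := fun t =>
    (hcol t).trans_lt ENNReal.ofReal_lt_top
  obtain ⟨N, hN⟩ := htail (η / 2) (half_pos hη)
  obtain ⟨δ, hδ, hδ1, hδC⟩ : ∃ δ : ℝ, 0 < δ ∧ δ ≤ 1 ∧ δ * C ≤ η / 2 := by
    refine ⟨min 1 (η / (2 * (C + 1))), lt_min one_pos (by positivity), min_le_left _ _, ?_⟩
    calc min 1 (η / (2 * (C + 1))) * C ≤ η / (2 * (C + 1)) * (C + 1) :=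
          mul_le_mul (min_le_right _ _) (by linarith) hC0 (by positivity)
      _ = η / 2 := by field_simp
  obtain ⟨ρ, hρ, hmod⟩ := h.exists_abs_greenKernel_sub_le N hδ
  obtain ⟨m, hm⟩ := exists_nat_gt (1 / ρ)
  have hm0 : (0 : ℝ) < m := (one_div_pos.2 hρ).trans hm
  have hmρ : 1 < m * ρ := (div_lt_iff₀ hρ).1 hm
  have hJ : ∀ k : ℤ, MeasurableSet {t : ℝ | ⌊m * t⌋ = k} := fun k =>
    (Int.measurable_floor.comp (measurable_const_mul (m : ℝ))) (measurableSet_singleton k)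
  have hJt : ∀ k : ℤ, volume {t : ℝ | ⌊m * t⌋ = k} ≠ ⊤ := fun k => by
    refine ((measure_mono ?_).trans_lt
      (measure_Icc_lt_top (μ := volume) (a := (k : ℝ) / m) (b := (k + 1 : ℝ) / m))).ne
    rintro t rfl
    rw [Set.mem_Icc, div_le_iff₀' hm0, le_div_iff₀' hm0]
    exact ⟨Int.floor_le _, (Int.lt_floor_add_one _).le⟩
  obtain ⟨F, hFc, hF⟩ := exists_compact_finite_rank (p := p)
    (Finset.Ico (-(m * N : ℤ)) (m * N)) (φ := fun k x => greenKernel u v x (k / m))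
    (fun k => h.memLp_greenKernel hp1 hp2 _ (hcolt _)) hJ hJt
  refine ⟨F, hFc, ?_⟩
  set H : ℝ → ℝ → ℝ := fun x t => ∑ k ∈ Finset.Ico (-(m * N : ℤ)) (m * N),
    greenKernel u v x (k / m) * {t : ℝ | ⌊m * t⌋ = k}.indicator 1 t with hH
  have hHeq : ∀ x t, H x t = if t ∈ Set.Ico (-N : ℝ) N
      then greenKernel u v x (⌊m * t⌋ / m) else 0 := fun x t => by
    have hiff : t ∈ Set.Ico (-N : ℝ) N ↔ ⌊m * t⌋ ∈ Finset.Ico (-(m * N : ℤ)) (m * N) := by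
      rw [Finset.mem_Ico, Int.le_floor, Int.floor_lt, Set.mem_Ico]
      push_cast
      rw [neg_mul_eq_mul_neg, mul_le_mul_iff_right₀ hm0, mul_lt_mul_iff_right₀ hm0]
    simp only [hH, Set.indicator_apply, Set.mem_ofPred_eq, Pi.one_apply, mul_ite, mul_one, mul_zero,
      hiff]
    rw [Finset.sum_ite_eq]
  have hpt : ∀ x t, ‖greenKernel u v x t - H x t‖ₑ ≤
      ENNReal.ofReal δ * ENNReal.ofReal (greenKernel u v x t) +
        (Set.Ico (-N : ℝ) N)ᶜ.indicator (fun t => ENNReal.ofReal (greenKernel u v x t)) t ∧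
      ‖greenKernel u v x t - H x t‖ₑ ≤ ENNReal.ofReal (greenKernel u v x t) := fun x t => by
    rw [hHeq]
    have hpos := (h.greenKernel_pos x t).le
    by_cases ht : t ∈ Set.Ico (-N : ℝ) N
    · rw [if_pos ht, Set.indicator_of_notMem (Set.notMem_compl_iff.2 ht), add_zero,
        ← ENNReal.ofReal_mul hδ.le, ← ofReal_norm, Real.norm_eq_abs]
      have h1 : (⌊m * t⌋ : ℝ) ≤ m * t := Int.floor_le _
      have h2 : m * t < ⌊m * t⌋ + 1 := Int.lt_floor_add_one _
      have h3 : (-(m * N : ℤ)) ≤ ⌊m * t⌋ := by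
        rw [Int.le_floor]; push_cast; nlinarith [ht.1]
      have h3' : -(m * N : ℝ) ≤ ⌊m * t⌋ := by exact_mod_cast h3
      have h4 : (⌊m * t⌋ : ℝ) / m ≤ t := (div_le_iff₀' hm0).2 h1
      have h5 : t - ρ < ⌊m * t⌋ / m := by rw [lt_div_iff₀' hm0]; linarith
      have hle := hmod (⌊m * t⌋ / m)
        ⟨by rw [le_div_iff₀' hm0]; linarith, h4.trans ht.2.le⟩ t ⟨ht.1, ht.2.le⟩
        (by rw [abs_lt]; constructor <;> linarith) x
      exact ⟨ENNReal.ofReal_le_ofReal hle,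
        ENNReal.ofReal_le_ofReal (hle.trans (mul_le_of_le_one_left hpos hδ1))⟩
    · rw [if_neg ht, sub_zero, h.enorm_greenKernel, Set.indicator_of_mem ht]
      exact ⟨le_add_self, le_rfl⟩
  have hKm : Measurable (Function.uncurry fun x t => greenKernel u v x t) :=
    h.continuous_greenKernel.measurable
  have hHm : Measurable (Function.uncurry H) := by
    refine Finset.measurable_sum _ fun k _ => Measurable.mul ?_ ?_
    · exact (h.continuous_greenKernel.comp
        (by fun_prop : Continuous fun z : ℝ × ℝ => (z.1, (k : ℝ) / m))).measurable
    · exact (measurable_one.indicator (hJ k)).comp measurable_snd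
  have hrow : ∀ x, ∫⁻ t, ‖greenKernel u v x t - H x t‖ₑ ≤ ENNReal.ofReal η := fun x => by
    refine (lintegral_mono fun t => (hpt x t).1).trans ?_
    rw [lintegral_add_left ((h.measurable_greenKernel x).const_mul _),
      lintegral_const_mul _ (h.measurable_greenKernel x),
      lintegral_indicator measurableSet_Ico.compl]
    calc _ ≤ ENNReal.ofReal δ * ENNReal.ofReal C + ENNReal.ofReal (η / 2) := by
          gcongr
          · exact hC x
          · exact hN x
      _ ≤ ENNReal.ofReal (η / 2) + ENNReal.ofReal (η / 2) := by
          rw [← ENNReal.ofReal_mul hδ.le]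
          gcongr
      _ = ENNReal.ofReal η := by
          rw [← ENNReal.ofReal_add (half_pos hη).le (half_pos hη).le, add_halves]
  have hcol' : ∀ t, ∫⁻ x, ‖greenKernel u v x t - H x t‖ₑ ≤ ENNReal.ofReal C := fun t =>
    (lintegral_mono fun x => (hpt x t).2).trans (hcol t)
  have hDm : Measurable (Function.uncurry fun x t => greenKernel u v x t - H x t) := hKm.sub hHm
  obtain ⟨T, hT, hTn⟩ := exists_clm_of_schur (p := p) hp1 hp2 hDm ENNReal.ofReal_ne_top
    ENNReal.ofReal_ne_top hrow hcol'
  suffices G - F = T by rwa [this]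
  ext1 f
  refine Lp.ext ?_
  have hrowG : ∀ x, ∫⁻ t, ‖greenKernel u v x t‖ₑ ≤ ENNReal.ofReal C := fun x => by
    simpa only [h.enorm_greenKernel] using hC x
  have hcolG : ∀ t, ∫⁻ x, ‖greenKernel u v x t‖ₑ ≤ ENNReal.ofReal C := fun t => by
    simpa only [h.enorm_greenKernel] using hcol t
  filter_upwards [Lp.coeFn_sub (G f) (F f), hG f, hF f, hT f,
    ae_integrable_kernel_mul hp1 hp2 hKm ENNReal.ofReal_ne_top ENNReal.ofReal_ne_top hrowG hcolG f,
    ae_integrable_kernel_mul hp1 hp2 hDm ENNReal.ofReal_ne_top ENNReal.ofReal_ne_top hrow hcol' f]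
    with x h1 h2 h3 h4 h5 h6
  have h7 : Integrable fun t => H x t * f t :=
    (h5.sub h6).congr (Eventually.of_forall fun t => by simp only [Pi.sub_apply]; ring)
  rw [_root_.sub_apply, h1, Pi.sub_apply, h2, h3, h4]
  simp_rw [sub_mul]
  exact (integral_sub h5 h7).symm

lemma isCompactOperator_of_isGreenOp [Fact (1 ≤ p)] (h : PFSS r q u v u' v') (hp1 : 1 < p)
    (hp2 : p ≠ ⊤) {C : ℝ} (hC0 : 0 ≤ C)
    (hC : ∀ x, ∫⁻ t, ENNReal.ofReal (greenKernel u v x t) ≤ ENNReal.ofReal C)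
    (htail : ∀ η : ℝ, 0 < η → ∃ N : ℕ, ∀ x,
      ∫⁻ t in (Set.Ico (-N : ℝ) N)ᶜ, ENNReal.ofReal (greenKernel u v x t) ≤ ENNReal.ofReal η)
    {G : LpR p →L[ℝ] LpR p} (hG : IsGreenOp u v p G) : IsCompactOperator G := by
  have hp : 1 < p.toReal := one_lt_toReal hp1 hp2
  have hlim : Tendsto (fun η : ℝ =>
      ((ENNReal.ofReal η ^ (p.toReal - 1) * ENNReal.ofReal C) ^ (1 / p.toReal)).toReal)
      (𝓝[>] 0) (𝓝 0) := by
    have hcont : Continuous fun η : ℝ => (max η 0 ^ (p.toReal - 1) * C) ^ (1 / p.toReal) :=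
      (((continuous_id.max continuous_const).rpow_const fun _ => Or.inr
        (sub_nonneg.2 hp.le)).mul_const C).rpow_const fun _ => Or.inr (by positivity)
    have h0 := (hcont.tendsto 0).mono_left (nhdsWithin_le_nhds (s := Set.Ioi 0))
    rw [max_self, Real.zero_rpow (sub_pos.2 hp).ne', zero_mul,
      Real.zero_rpow (one_div_pos.2 (one_pos.trans hp)).ne'] at h0
    refine h0.congr fun η => ?_
    rw [← ENNReal.toReal_rpow, ENNReal.toReal_mul, ← ENNReal.toReal_rpow, ENNReal.toReal_ofReal',
      ENNReal.toReal_ofReal hC0]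
  refine isClosed_setOfPred_isCompactOperator.closure_subset
    (Metric.mem_closure_iff.2 fun ε hε => ?_)
  obtain ⟨η, hηε, hη⟩ := ((hlim.eventually_lt_const hε).and self_mem_nhdsWithin).exists
  obtain ⟨F, hFc, hF⟩ := h.exists_compact_norm_sub_le hp1 hp2 hC0 hC htail hG hη
  exact ⟨F, hFc, by rw [dist_eq_norm]; exact hF.trans_lt hηε⟩

end PFSS

/-- **Corollary 3.7.** Assume (1.2), (1.3), let `u, v` be a principal FSS and
`p ∈ (1,∞)`.  If the Steklov average `A(x) = (1/(2d(x))) ∫_{x-d(x)}^{x+d(x)} q`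
satisfies `inf_x A(x) > 0` (so `G` is bounded) and `A(x) → ∞` as `|x| → ∞`,
then the Green operator is bounded and compact on `L_p(ℝ)`. -/
theorem compact_green_of_steklov_tendsto_atTop
    (r q u v u' v' d₁ d₂ d : ℝ → ℝ) (p : ℝ≥0∞) (hp1 : 1 < p) (hp2 : p ≠ ⊤)
    [Fact (1 ≤ p)]
    (h12 : Cond12 r q) (h13 : Cond13 r q) (hfss : PFSS r q u v u' v')
    (hd₁ : IsD1 r q d₁) (hd₂ : IsD2 r q d₂) (hd : IsD r (hF r d₁ d₂) d)
    (A : ℝ → ℝ)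
    (hA : ∀ x : ℝ, A x = (1 / (2 * d x)) * ∫ t in x - d x..x + d x, q t)
    (hApos : ∃ ε : ℝ, 0 < ε ∧ ∀ x : ℝ, ε ≤ A x)
    (hAtop : Tendsto A (cocompact ℝ) atTop) :
    ∃ G : LpR p →L[ℝ] LpR p, IsGreenOp u v p G ∧ IsCompactOperator G := by
  obtain ⟨C, hC0, hC⟩ := hfss.exists_lintegral_greenKernel_le h12 hd₁ hd₂ hd
  obtain ⟨ε, hε, hAε⟩ := hApos
  simp only [← hA] at hC
  have hrow : ∀ x, ∫⁻ t, ENNReal.ofReal (greenKernel u v x t) ≤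
      ENNReal.ofReal (C / ε) := fun x => by
    simpa using hC ε hε Set.univ MeasurableSet.univ (fun y _ => hAε y) x
  have hcol : ∀ t, ∫⁻ x, ENNReal.ofReal (greenKernel u v x t) ≤
      ENNReal.ofReal (C / ε) := fun t => by
    simp_rw [fun x => hfss.greenKernel_comm x t]
    exact hrow t
  have htail : ∀ η : ℝ, 0 < η → ∃ N : ℕ, ∀ x,
      ∫⁻ t in (Set.Ico (-N : ℝ) N)ᶜ, ENNReal.ofReal (greenKernel u v x t) ≤ ENNReal.ofReal η := by
    intro η hη
    obtain ⟨s, hs, hsA⟩ := mem_cocompact.1 (hAtop.eventually_ge_atTop ((C + 1) / η))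
    obtain ⟨R, hR⟩ := hs.isBounded.subset_ball 0
    obtain ⟨N, hN⟩ := exists_nat_gt R
    refine ⟨N, fun x => (hC ((C + 1) / η) (by positivity) _ measurableSet_Ico.compl
      (fun y hy => hsA fun hys => hy ?_) x).trans (ENNReal.ofReal_le_ofReal ?_)⟩
    · have hyR := abs_lt.1 (mem_ball_zero_iff.1 (hR hys))
      exact ⟨by linarith, by linarith⟩
    · rw [div_le_iff₀ (by positivity), mul_div_cancel₀ _ hη.ne']
      linarith
  obtain ⟨G, hG, -⟩ := exists_clm_of_schur (p := p) (K := greenKernel u v) hp1 hp2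
    hfss.continuous_greenKernel.measurable ENNReal.ofReal_ne_top ENNReal.ofReal_ne_top
    (fun x => by simpa only [hfss.enorm_greenKernel] using hrow x)
    (fun t => by simpa only [hfss.enorm_greenKernel] using hcol t)
  exact ⟨G, hG, hfss.isCompactOperator_of_isGreenOp hp1 hp2 (div_nonneg hC0 hε.le) hrow htail hG⟩
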